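/- arXiv:2404.11625 — 2 statements merged into one kernel-verified Lean document; each statement's English description precedes it below -/
import Mathlib

section
/- The three points A_Y, B_Y, C_Y all lie on the circle with diameter GH (the orthocentroidal circle of triangle ABC), where G is the centroid and H is the orthocenter of triangle ABC. -/
open EuclideanGeometry RealInnerProductSpace

/-- The Euclidean plane. -/
abbrev Pt := EuclideanSpace ℝ (Fin 2)

/-- If the radical axis of the circles centered at `P` and `Q` contains `A`, `X` and the midpoint
of `BC`, and these circles touch `BC` at `B` and `C`, then `X` sees `GH` under a right angle. -/
theorem inner_sub_centroid_sub_orthocenter_eq_zero {A B C H X P Q : Pt}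
    (hABC : ¬ Collinear ℝ {A, B, C})
    (hA : ⟪H - A, C - B⟫ = 0) (hB : ⟪H - B, C - A⟫ = 0)
    (hP : dist P A = dist P B) (hPt : ⟪P - B, C - B⟫ = 0)
    (hQ : dist Q A = dist Q C) (hQt : ⟪Q - C, B - C⟫ = 0)
    (hPX : dist P X = dist P A) (hQX : dist Q X = dist Q A) (hX : X ≠ A) :
    ⟪X - (3 : ℝ)⁻¹ • (A + B + C), X - H⟫ = 0 := by
  have hBC : B ≠ C := ne₂₃_of_not_collinear hABC
  set M : Pt := midpoint ℝ B C with hM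
  have hAM : A ≠ M := by
    rintro h
    have hcol := (wbtw_midpoint ℝ B C).collinear
    rw [← hM, ← h] at hcol
    exact hABC (hcol.subset (by
      intro x hx
      simp only [Set.mem_insert_iff, Set.mem_singleton_iff] at hx ⊢
      tauto))
  have hM2 : M = (2 : ℝ)⁻¹ • (B + C) := by rw [hM, midpoint_eq_smul_add, invOf_eq_inv]
  have hPQ : P ≠ Q := by
    rintro rfl
    apply hBC
    have h : ⟪C - B, C - B⟫ = 0 := by
      have h1 : C - B = (P - B) - (P - C) := by abel
      have h2 : B - C = -(C - B) := by abel
      rw [h2, inner_neg_right, neg_eq_zero] at hQt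
      nth_rewrite 1 [h1]
      rw [inner_sub_left, hPt, hQt, sub_zero]
    exact (sub_eq_zero.mp (inner_self_eq_zero.mp h)).symm
  have hdist : ∀ {U V W : Pt}, dist U V = dist U W →
      (U 0 - V 0) ^ 2 + (U 1 - V 1) ^ 2 = (U 0 - W 0) ^ 2 + (U 1 - W 1) ^ 2 := by
    intro U V W h
    have h' := congrArg (· ^ 2) h
    simpa [EuclideanSpace.dist_sq_eq, Real.dist_eq, sq_abs] using h'
  have hM0 : M 0 = (B 0 + C 0) / 2 := by rw [hM2]; simp; ring
  have hM1 : M 1 = (B 1 + C 1) / 2 := by rw [hM2]; simp; ring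
  have e1 := hdist hP
  have e2 := hdist hQ
  have e3 := hdist hPX
  have e4 := hdist hQX
  simp only [PiLp.inner_apply, Fin.sum_univ_two, PiLp.sub_apply, PiLp.add_apply, PiLp.smul_apply,
    RCLike.inner_apply, conj_trivial, smul_eq_mul] at hA hB hPt hQt ⊢
  have radX : (P 0 - Q 0) * (X 0 - A 0) + (P 1 - Q 1) * (X 1 - A 1) = 0 := by
    linear_combination (e4 - e3) / 2
  have radM : (P 0 - Q 0) * (M 0 - A 0) + (P 1 - Q 1) * (M 1 - A 1) = 0 := by
    rw [hM0, hM1]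
    linear_combination (e1 - e2) / 2 + hPt / 2 - hQt / 2
  have det : (X 0 - A 0) * (M 1 - A 1) = (X 1 - A 1) * (M 0 - A 0) := by
    by_contra hne
    apply hPQ
    have hne' := sub_ne_zero.mpr hne
    ext i
    rw [← sub_eq_zero]
    apply (mul_eq_zero.mp ?_).resolve_left hne'
    fin_cases i
    · simp only [Fin.zero_eta]
      linear_combination (M 1 - A 1) * radX - (X 1 - A 1) * radM
    · simp only [Fin.mk_one]
      linear_combination (X 0 - A 0) * radM - (M 0 - A 0) * radX
  obtain ⟨t, h0, h1⟩ : ∃ t : ℝ, X 0 = A 0 + t * (M 0 - A 0) ∧ X 1 = A 1 + t * (M 1 - A 1) := by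
    by_cases h : M 0 - A 0 = 0
    · have h' : M 1 - A 1 ≠ 0 := by
        intro h'
        apply hAM
        ext i
        fin_cases i
        · exact (sub_eq_zero.mp h).symm
        · exact (sub_eq_zero.mp h').symm
      refine ⟨(X 1 - A 1) / (M 1 - A 1), ?_, ?_⟩
      · field_simp
        linear_combination det
      · field_simp
        ring
    · refine ⟨(X 0 - A 0) / (M 0 - A 0), ?_, ?_⟩
      · field_simp
        ring
      · field_simp
        linear_combination -det
  have ht : t ≠ 0 := by
    rintro rfl
    apply hX
    ext i
    fin_cases i
    · simpa using h0
    · simpa using h1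
  have power : t * ((M 0 - A 0) ^ 2 + (M 1 - A 1) ^ 2) =
      2 * ((M 0 - A 0) * (P 0 - A 0) + (M 1 - A 1) * (P 1 - A 1)) := by
    apply mul_left_cancel₀ ht
    rw [h0, h1] at e3
    linear_combination e3
  have inversion : (1 - t) * ((M 0 - A 0) ^ 2 + (M 1 - A 1) ^ 2) =
      ((C 0 - B 0) ^ 2 + (C 1 - B 1) ^ 2) / 4 := by
    rw [sub_mul, power, hM0, hM1]
    linear_combination -e1 - hPt
  have altitudes : (H 0 - M 0) * (A 0 - M 0) + (H 1 - M 1) * (A 1 - M 1) =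
      ((C 0 - B 0) ^ 2 + (C 1 - B 1) ^ 2) / 4 := by
    rw [hM0, hM1]
    linear_combination hA / 2 - hB
  rw [h0, h1]
  rw [hM0, hM1] at inversion altitudes ⊢
  linear_combination (2 / 3 - t) * (inversion - altitudes)

/-- Thales' theorem, in terms of the midpoint. -/
theorem dist_midpoint_eq_of_inner_eq_zero {G H X : Pt} (h : ⟪X - G, X - H⟫ = 0) :
    dist (midpoint ℝ G H) X = dist G H / 2 := by
  have hmid : midpoint ℝ G H - X = -(2 : ℝ)⁻¹ • ((X - G) + (X - H)) := by
    rw [midpoint_eq_smul_add, invOf_eq_inv]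
    module
  have hGH : G - H = (X - H) - (X - G) := by abel
  rw [dist_eq_norm, dist_eq_norm, hmid, hGH, norm_smul,
    norm_sub_eq_norm_add h, add_comm (X - H)]
  norm_num
  ring

/-- The points `A_Y`, `B_Y`, `C_Y` lie on the circle with diameter `GH` (the
orthocentroidal circle of triangle `ABC`), where `G` is the centroid and `H` the
orthocenter. -/
theorem stmt_18 (A B C G H A_Y B_Y C_Y P₁ P₂ Q₁ Q₂ R₁ R₂ : Pt)
    (hABC : AffineIndependent ℝ ![A, B, C])
    -- G is the centroid of triangle ABC
    (hG : G = (3 : ℝ)⁻¹ • (A + B + C))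
    -- H is the orthocenter of triangle ABC
    (hH₁ : ⟪H - A, C - B⟫ = 0) (hH₂ : ⟪H - B, C - A⟫ = 0)
    -- A_Y : second intersection (≠ A) of the circle through A, B tangent to BC at B
    -- with the circle through A, C tangent to BC at C
    (hP₁ : dist P₁ A = dist P₁ B) (hP₁t : ⟪P₁ - B, C - B⟫ = 0)
    (hP₂ : dist P₂ A = dist P₂ C) (hP₂t : ⟪P₂ - C, B - C⟫ = 0)
    (hAY₁ : dist P₁ A_Y = dist P₁ A) (hAY₂ : dist P₂ A_Y = dist P₂ A)
    (hAY : A_Y ≠ A)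
    -- B_Y : second intersection (≠ B) of the circle through B, C tangent to CA at C
    -- with the circle through B, A tangent to CA at A
    (hQ₁ : dist Q₁ B = dist Q₁ C) (hQ₁t : ⟪Q₁ - C, A - C⟫ = 0)
    (hQ₂ : dist Q₂ B = dist Q₂ A) (hQ₂t : ⟪Q₂ - A, C - A⟫ = 0)
    (hBY₁ : dist Q₁ B_Y = dist Q₁ B) (hBY₂ : dist Q₂ B_Y = dist Q₂ B)
    (hBY : B_Y ≠ B)
    -- C_Y : second intersection (≠ C) of the circle through C, A tangent to AB at A
    -- with the circle through C, B tangent to AB at B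
    (hR₁ : dist R₁ C = dist R₁ A) (hR₁t : ⟪R₁ - A, B - A⟫ = 0)
    (hR₂ : dist R₂ C = dist R₂ B) (hR₂t : ⟪R₂ - B, A - B⟫ = 0)
    (hCY₁ : dist R₁ C_Y = dist R₁ C) (hCY₂ : dist R₂ C_Y = dist R₂ C)
    (hCY : C_Y ≠ C) :
    dist (midpoint ℝ G H) A_Y = dist G H / 2 ∧
      dist (midpoint ℝ G H) B_Y = dist G H / 2 ∧
        dist (midpoint ℝ G H) C_Y = dist G H / 2 := by
  have hn := affineIndependent_iff_not_collinear_set.mp hABC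
  have hn' : ¬ Collinear ℝ {B, C, A} := by
    rwa [show ({B, C, A} : Set Pt) = {A, B, C} by grind]
  have hn'' : ¬ Collinear ℝ {C, A, B} := by
    rwa [show ({C, A, B} : Set Pt) = {A, B, C} by grind]
  have hB : ⟪H - B, A - C⟫ = 0 := by rw [← neg_sub C A, inner_neg_right, hH₂, neg_zero]
  have hC : ⟪H - C, B - A⟫ = 0 := by
    simp only [inner_sub_left, inner_sub_right, real_inner_comm] at hH₁ hH₂ ⊢
    linarith [real_inner_comm A B, real_inner_comm A C, real_inner_comm B C]
  have hC' : ⟪H - C, A - B⟫ = 0 := by rw [← neg_sub B A, inner_neg_right, hC, neg_zero]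
  have hA' : ⟪H - A, B - C⟫ = 0 := by rw [← neg_sub C B, inner_neg_right, hH₁, neg_zero]
  have hGB : G = (3 : ℝ)⁻¹ • (B + C + A) := by rw [hG]; congr 1; abel
  have hGC : G = (3 : ℝ)⁻¹ • (C + A + B) := by rw [hG]; congr 1; abel
  refine ⟨dist_midpoint_eq_of_inner_eq_zero ?_, dist_midpoint_eq_of_inner_eq_zero ?_,
    dist_midpoint_eq_of_inner_eq_zero ?_⟩
  · rw [hG]
    exact inner_sub_centroid_sub_orthocenter_eq_zero hn hH₁ hH₂ hP₁ hP₁t hP₂ hP₂t hAY₁ hAY₂ hAY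
  · rw [hGB]
    exact inner_sub_centroid_sub_orthocenter_eq_zero hn' hB hC' hQ₁ hQ₁t hQ₂ hQ₂t hBY₁ hBY₂ hBY
  · rw [hGC]
    exact inner_sub_centroid_sub_orthocenter_eq_zero hn'' hC hA' hR₁ hR₁t hR₂ hR₂t hCY₁ hCY₂ hCY
end

section
/- Let D and E be points on segment BC such that the cevians AD and AE are isogonal with respect to angle A of triangle ABC (i.e., ∠BAD = ∠EAC). Then the circumcircle of triangle ABC is tangent to the circumcircle of triangle ADE at A. -/
open EuclideanGeometry RealInnerProductSpace

/-- The signed area of the parallelogram spanned by `P - A` and `Q - A`. -/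
def signedArea (A P Q : Pt) : ℝ :=
  (P 0 - A 0) * (Q 1 - A 1) - (P 1 - A 1) * (Q 0 - A 0)

lemma collinear_of_signedArea_eq_zero {A P Q : Pt} (h : signedArea A P Q = 0) :
    Collinear ℝ ({A, P, Q} : Set Pt) := by
  rw [signedArea] at h
  by_cases hP : P = A
  · simpa [hP] using collinear_pair ℝ A Q
  have hN : (P 0 - A 0) ^ 2 + (P 1 - A 1) ^ 2 ≠ 0 := by
    intro hN
    refine hP (PiLp.ext fun i => ?_)
    fin_cases i <;> simp only [Fin.zero_eta, Fin.mk_one] <;>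
      nlinarith [sq_nonneg (P 0 - A 0), sq_nonneg (P 1 - A 1)]
  rw [collinear_iff_of_mem (p₀ := A) (by simp)]
  refine ⟨P - A, ?_⟩
  rintro x (rfl | rfl | rfl)
  · exact ⟨0, by simp⟩
  · exact ⟨1, by simp⟩
  · refine ⟨((P 0 - A 0) * (x 0 - A 0) + (P 1 - A 1) * (x 1 - A 1)) /
      ((P 0 - A 0) ^ 2 + (P 1 - A 1) ^ 2), PiLp.ext fun i => ?_⟩
    fin_cases i <;> simp <;> field_simp
    · linear_combination (A 1 - P 1) * h
    · linear_combination (P 0 - A 0) * h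

lemma signedArea_ne_zero_of_affineIndependent {A B C : Pt}
    (h : AffineIndependent ℝ ![A, B, C]) : signedArea A B C ≠ 0 := fun h0 =>
  affineIndependent_iff_not_collinear_set.1 h (collinear_of_signedArea_eq_zero h0)

lemma inner_vsub_eq (A P Q : Pt) :
    ⟪P -ᵥ A, Q -ᵥ A⟫ = (P 0 - A 0) * (Q 0 - A 0) + (P 1 - A 1) * (Q 1 - A 1) := by
  simp [PiLp.inner_apply, Fin.sum_univ_two, mul_comm]

lemma cos_angle_mul_norm_mul_norm_eq (P A Q : Pt) :
    Real.cos (∠ P A Q) * (‖P -ᵥ A‖ * ‖Q -ᵥ A‖) =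
      (P 0 - A 0) * (Q 0 - A 0) + (P 1 - A 1) * (Q 1 - A 1) := by
  rw [EuclideanGeometry.angle, InnerProductGeometry.cos_angle_mul_norm_mul_norm, inner_vsub_eq]

lemma sin_angle_mul_norm_mul_norm_eq (P A Q : Pt) :
    Real.sin (∠ P A Q) * (‖P -ᵥ A‖ * ‖Q -ᵥ A‖) = |signedArea A P Q| := by
  rw [EuclideanGeometry.angle, InnerProductGeometry.sin_angle_mul_norm_mul_norm,
    inner_vsub_eq, inner_vsub_eq, inner_vsub_eq, ← Real.sqrt_sq_eq_abs, signedArea]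
  congr 1
  ring

/-- Equal unoriented angles have equal cotangents, in division-free form. -/
lemma inner_mul_abs_signedArea_eq_of_angle_eq {A P Q R S : Pt} (h : ∠ P A Q = ∠ R A S) :
    ((P 0 - A 0) * (Q 0 - A 0) + (P 1 - A 1) * (Q 1 - A 1)) * |signedArea A R S| =
      ((R 0 - A 0) * (S 0 - A 0) + (R 1 - A 1) * (S 1 - A 1)) * |signedArea A P Q| := by
  rw [← cos_angle_mul_norm_mul_norm_eq P, ← cos_angle_mul_norm_mul_norm_eq R,
    ← sin_angle_mul_norm_mul_norm_eq, ← sin_angle_mul_norm_mul_norm_eq, h]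
  ring

lemma sq_add_sq_eq_of_dist_eq {O P Q : Pt} (h : dist O P = dist O Q) :
    (O 0 - P 0) ^ 2 + (O 1 - P 1) ^ 2 = (O 0 - Q 0) ^ 2 + (O 1 - Q 1) ^ 2 := by
  have h2 := congrArg (· ^ 2) h
  simpa [EuclideanSpace.dist_sq_eq, Fin.sum_univ_two, Real.dist_eq, sq_abs] using h2

lemma exists_coord_eq_of_mem_segment {B C D : Pt} (h : D ∈ segment ℝ B C) :
    ∃ s : ℝ, 0 ≤ s ∧ s ≤ 1 ∧ ∀ i, D i = (1 - s) * B i + s * C i := by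
  obtain ⟨a, s, ha, hs, hsum, rfl⟩ := h
  obtain rfl : a = 1 - s := by linarith
  exact ⟨s, hs, by linarith, fun i => by simp⟩

/-- If `D`, `E` on segment `BC` are such that `AD` and `AE` are isogonal cevians with
respect to angle `A` (i.e. `∠BAD = ∠EAC`), then the circumcircle of `ABC` is tangent to
the circumcircle of `ADE` at `A` (the two centers are collinear with the common point
`A`). -/
theorem stmt_19 (A B C D E O O' : Pt)
    (hABC : AffineIndependent ℝ ![A, B, C])
    -- D and E lie on segment BC
    (hD : D ∈ segment ℝ B C) (hE : E ∈ segment ℝ B C)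
    (hDE : D ≠ E)
    -- AD and AE are isogonal with respect to angle A
    (hiso : ∠ B A D = ∠ E A C)
    -- O is the circumcenter of triangle ABC
    (hOA : dist O A = dist O B) (hOB : dist O B = dist O C)
    -- O' is the circumcenter of triangle ADE
    (hO'A : dist O' A = dist O' D) (hO'D : dist O' D = dist O' E) :
    Collinear ℝ ({A, O, O'} : Set Pt) := by
  have hK := signedArea_ne_zero_of_affineIndependent hABC
  obtain ⟨s, hs0, hs1, hDs⟩ := exists_coord_eq_of_mem_segment hD
  obtain ⟨t, ht0, ht1, hEt⟩ := exists_coord_eq_of_mem_segment hE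
  have hst : s - t ≠ 0 := by
    intro h
    refine hDE (PiLp.ext fun i => ?_)
    rw [hDs, hEt, sub_eq_zero.1 h]
  have hareaD : signedArea A B D = s * signedArea A B C := by
    simp only [signedArea, hDs]; ring
  have hareaE : signedArea A E C = (1 - t) * signedArea A B C := by
    simp only [signedArea, hEt]; ring
  have hang := inner_mul_abs_signedArea_eq_of_angle_eq hiso
  rw [hareaD, hareaE, abs_mul, abs_mul, abs_of_nonneg hs0, abs_of_nonneg (by linarith : 0 ≤ 1 - t),
    ← mul_assoc, ← mul_assoc] at hang
  replace hang := mul_right_cancel₀ (abs_ne_zero.2 hK) hang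
  have h1 := sq_add_sq_eq_of_dist_eq hOA
  have h2 := sq_add_sq_eq_of_dist_eq (hOA.trans hOB)
  have h3 := sq_add_sq_eq_of_dist_eq hO'A
  have h4 := sq_add_sq_eq_of_dist_eq (hO'A.trans hO'D)
  simp only [hDs, hEt] at hang h3 h4
  apply collinear_of_signedArea_eq_zero
  simp only [signedArea] at hK ⊢
  obtain ⟨b₀, hb₀⟩ : ∃ x, x = B 0 - A 0 := ⟨_, rfl⟩
  obtain ⟨b₁, hb₁⟩ : ∃ x, x = B 1 - A 1 := ⟨_, rfl⟩
  obtain ⟨c₀, hc₀⟩ : ∃ x, x = C 0 - A 0 := ⟨_, rfl⟩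
  obtain ⟨c₁, hc₁⟩ : ∃ x, x = C 1 - A 1 := ⟨_, rfl⟩
  obtain ⟨o₀, ho₀⟩ : ∃ x, x = O 0 - A 0 := ⟨_, rfl⟩
  obtain ⟨o₁, ho₁⟩ : ∃ x, x = O 1 - A 1 := ⟨_, rfl⟩
  obtain ⟨q₀, hq₀⟩ : ∃ x, x = O' 0 - A 0 := ⟨_, rfl⟩
  obtain ⟨q₁, hq₁⟩ : ∃ x, x = O' 1 - A 1 := ⟨_, rfl⟩
  rw [← hb₀, ← hb₁, ← hc₀, ← hc₁] at hK
  rw [← ho₀, ← ho₁, ← hq₀, ← hq₁]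
  rw [eq_sub_iff_add_eq'] at hb₀ hb₁ hc₀ hc₁ ho₀ ho₁ hq₀ hq₁
  simp only [← hb₀, ← hb₁, ← hc₀, ← hc₁, ← ho₀, ← ho₁, ← hq₀, ← hq₁] at hang h1 h2 h3 h4
  have hratio : (1 - s) * (1 - t) * (b₀ ^ 2 + b₁ ^ 2) = s * t * (c₀ ^ 2 + c₁ ^ 2) := by
    linear_combination hang
  have hOb : 2 * (o₀ * b₀ + o₁ * b₁) = b₀ ^ 2 + b₁ ^ 2 := by linear_combination h1
  have hOc : 2 * (o₀ * c₀ + o₁ * c₁) = c₀ ^ 2 + c₁ ^ 2 := by linear_combination h2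
  have hOb' : 2 * (q₀ * b₀ + q₁ * b₁) =
      b₀ ^ 2 + b₁ ^ 2 - s * t * ((b₀ - c₀) ^ 2 + (b₁ - c₁) ^ 2) := by
    refine mul_left_cancel₀ hst ?_
    linear_combination s * h4 - t * h3
  have hOc' : 2 * (q₀ * c₀ + q₁ * c₁) =
      c₀ ^ 2 + c₁ ^ 2 - (1 - s) * (1 - t) * ((b₀ - c₀) ^ 2 + (b₁ - c₁) ^ 2) := by
    refine mul_left_cancel₀ hst ?_
    linear_combination (1 - t) * h3 - (1 - s) * h4
  refine mul_left_cancel₀ hK ?_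
  linear_combination (q₀ * c₀ + q₁ * c₁) / 2 * hOb - (q₀ * b₀ + q₁ * b₁) / 2 * hOc +
    (b₀ ^ 2 + b₁ ^ 2) / 4 * hOc' - (c₀ ^ 2 + c₁ ^ 2) / 4 * hOb' -
    ((b₀ - c₀) ^ 2 + (b₁ - c₁) ^ 2) / 4 * hratio
end
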